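/- Under the centered model with M_Z > 3 and for any λ ≥ 1, the set of stationary points {(α,β) ∈ ℝ × ℝ^d : ∇L^h_λ(α,β) = 0} equals S₁ ∪ S₂, where S₁ = {(0, β^h), (0, −β^h)} with β^h = ((1 + 1/‖μ‖₂²)/(‖μ‖₂⁴ + 6‖μ‖₂² + M_Z))^{1/2} μ, and S₂ = {(0, β) : μ^⊤β = 0, ‖β‖₂² = 1/M_Z} ∪ {(0, 0)}. Moreover, both points of S₁ are global minimizers of L^h_λ. -/

import Mathlib

open MeasureTheory ProbabilityTheory
open scoped RealInnerProductSpace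

/-- `ℝ^d` with the Euclidean norm. -/
abbrev Vec (d : ℕ) := EuclideanSpace ℝ (Fin d)

/-- `ℝ × ℝ^d` with the Euclidean (ℓ²) norm, the domain of the loss `(α, β) ↦ L(α, β)`. -/
abbrev Pr (d : ℕ) := WithLp 2 (ℝ × Vec d)

/-- Build the point `(α, β) ∈ ℝ × ℝ^d`. -/
noncomputable def mkp {d : ℕ} (α : ℝ) (β : Vec d) : Pr d :=
  (WithLp.equiv 2 (ℝ × Vec d)).symm (α, β)

/-- The quartic loss `h(x) = (x² - 1)² / 4`. -/
noncomputable def hq (x : ℝ) : ℝ := (x ^ 2 - 1) ^ 2 / 4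

/-- The population loss `γ = (α, β) ↦ E g(α + β⊤X) + (λ/2) α²` built from a scalar loss `g`. -/
noncomputable def popLoss {d : ℕ} {Ω : Type*} [MeasurableSpace Ω] (P : Measure Ω)
    (X : Ω → Vec d) (g : ℝ → ℝ) (lam : ℝ) (γ : Pr d) : ℝ :=
  (∫ ω, g ((WithLp.equiv 2 (ℝ × Vec d) γ).1 + ⟪(WithLp.equiv 2 (ℝ × Vec d) γ).2, X ω⟫) ∂P)
    + lam / 2 * ((WithLp.equiv 2 (ℝ × Vec d) γ).1) ^ 2


/-- The special direction `β^h = ((1 + 1/‖μ‖²)/(‖μ‖⁴ + 6‖μ‖² + M_Z))^{1/2} μ`. -/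
noncomputable def betah {d : ℕ} (μ : Vec d) (MZ : ℝ) : Vec d :=
  Real.sqrt ((1 + 1 / ‖μ‖ ^ 2) / (‖μ‖ ^ 4 + 6 * ‖μ‖ ^ 2 + MZ)) • μ


theorem mean_Y {Ω : Type*} [MeasurableSpace Ω] (P : Measure Ω) [IsProbabilityMeasure P]
    (Y : Ω → ℝ) (hY : Measurable Y) (hYpm : ∀ ω, Y ω = 1 ∨ Y ω = -1)
    (hY1 : P {ω | Y ω = 1} = 1 / 2) : ∫ ω, Y ω ∂P = 0 := by
  have hs : MeasurableSet {ω | Y ω = 1} := hY (measurableSet_singleton 1)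
  have h : ∀ ω, Y ω = 2 * ({ω | Y ω = 1}.indicator (fun _ => (1:ℝ)) ω) - 1 := by
    intro ω
    rcases hYpm ω with h | h
    · simp [h]; norm_num
    · have : ω ∉ {ω | Y ω = 1} := by simp [h]; norm_num
      rw [Set.indicator_of_notMem this, h]; norm_num
  have hi : Integrable ({ω | Y ω = 1}.indicator (fun _ => (1:ℝ))) P :=
    (integrable_const 1).indicator hs
  rw [integral_congr_ae (Filter.Eventually.of_forall h), integral_sub (hi.const_mul 2)
    (integrable_const _), integral_const_mul, integral_indicator_const _ hs]
  simp [Measure.real, hY1]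

theorem memLp_W {d : ℕ} {Ω : Type*} [MeasurableSpace Ω] (P : Measure Ω) [IsProbabilityMeasure P]
    (Z : Ω → Vec d) (hZ : Measurable Z)
    (hZsg : ∀ u : Vec d, ‖u‖ = 1 → Integrable (fun ω => |⟪u, Z ω⟫| ^ (4:ℝ)) P) (β : Vec d)
    (k : ℕ) (hk : k ≤ 4) :
    Integrable (fun ω => ⟪β, Z ω⟫ ^ k) P := by
  have key : ∀ u : Vec d, ‖u‖ = 1 → Integrable (fun ω => ⟪u, Z ω⟫ ^ k) P := by
    intro u hu
    have h4 := hZsg u hu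
    have hm : Measurable (fun ω => ⟪u, Z ω⟫) := by fun_prop
    refine (h4.add (integrable_const 1)).mono' (hm.pow_const k).aestronglyMeasurable
      (Filter.Eventually.of_forall fun ω => ?_)
    have e : |⟪u, Z ω⟫| ^ (4:ℝ) = |⟪u, Z ω⟫| ^ 4 := by
      exact_mod_cast Real.rpow_natCast _ 4
    simp only [Pi.add_apply, e, norm_pow, Real.norm_eq_abs]
    set t := |⟪u, Z ω⟫|
    have ht : 0 ≤ t := abs_nonneg _
    rcases le_total t 1 with h | h
    · have := pow_le_one₀ (n := k) ht h
      have := pow_nonneg ht 4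
      linarith
    · have := pow_le_pow_right₀ h hk
      linarith
  by_cases hβ : β = 0
  · subst hβ; simp
  · have hn : ‖β‖ ≠ 0 := norm_ne_zero_iff.2 hβ
    have := (key (‖β‖⁻¹ • β) (by rw [norm_smul, norm_inv, norm_norm, inv_mul_cancel₀ hn])).const_mul
      (‖β‖ ^ k)
    refine this.congr (Filter.Eventually.of_forall fun ω => ?_)
    simp only [inner_smul_left, ← mul_pow]
    simp [hn]

theorem odd_W {d : ℕ} {Ω : Type*} [MeasurableSpace Ω] (P : Measure Ω)
    (Z : Ω → Vec d) (hZ : Measurable Z)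
    (hZsym : ∀ O : Vec d ≃ₗᵢ[ℝ] Vec d,
      Measure.map (fun ω => O (Z ω)) P = Measure.map Z P) (β : Vec d) (k : ℕ) (hk : Odd k) :
    ∫ ω, ⟪β, Z ω⟫ ^ k ∂P = 0 := by
  have h := hZsym (LinearIsometryEquiv.neg ℝ)
  have hf : Continuous (fun z : Vec d => ⟪β, z⟫ ^ k) := by fun_prop
  have h1 := integral_map (μ := P) hZ.aemeasurable (f := fun z : Vec d => ⟪β, z⟫ ^ k)
    hf.aestronglyMeasurable
  have hZ' : Measurable (fun ω => (LinearIsometryEquiv.neg ℝ : Vec d ≃ₗᵢ[ℝ] Vec d) (Z ω)) := by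
    exact hZ.neg
  have h2 := integral_map (μ := P) hZ'.aemeasurable (f := fun z : Vec d => ⟪β, z⟫ ^ k)
    hf.aestronglyMeasurable
  rw [h, h1] at h2
  simp only [LinearIsometryEquiv.coe_neg, inner_neg_right, hk.neg_pow, integral_neg] at h2
  linarith

theorem four_W {d : ℕ} {Ω : Type*} [MeasurableSpace Ω] (P : Measure Ω)
    (Z : Ω → Vec d) (MZ : ℝ)
    (hMZ : ∀ u : Vec d, ‖u‖ = 1 → (∫ ω, ⟪u, Z ω⟫ ^ 4 ∂P) = MZ) (β : Vec d) :
    ∫ ω, ⟪β, Z ω⟫ ^ 4 ∂P = MZ * (‖β‖ ^ 2) ^ 2 := by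
  by_cases hβ : β = 0
  · subst hβ; simp
  · have hn : ‖β‖ ≠ 0 := norm_ne_zero_iff.2 hβ
    have := hMZ (‖β‖⁻¹ • β) (by rw [norm_smul, norm_inv, norm_norm, inv_mul_cancel₀ hn])
    simp only [inner_smul_left, mul_pow, integral_const_mul] at this
    rw [← this]
    simp
    field_simp

/-- The explicit polynomial form. -/
noncomputable def polyL {d : ℕ} (μ : Vec d) (MZ lam : ℝ) (γ : Pr d) : ℝ :=
  (γ.fst ^ 4 + 6 * γ.fst ^ 2 * ⟪γ.snd, μ⟫ ^ 2 + ⟪γ.snd, μ⟫ ^ 4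
    + 6 * (γ.fst ^ 2 + ⟪γ.snd, μ⟫ ^ 2) * ⟪γ.snd, γ.snd⟫ + MZ * ⟪γ.snd, γ.snd⟫ ^ 2
    - 2 * γ.fst ^ 2 - 2 * ⟪γ.snd, μ⟫ ^ 2 - 2 * ⟪γ.snd, γ.snd⟫ + 1) / 4 + lam / 2 * γ.fst ^ 2

theorem popLoss_eq {d : ℕ} {Ω : Type*} [MeasurableSpace Ω] (P : Measure Ω) [IsProbabilityMeasure P]
    (Y : Ω → ℝ) (Z : Ω → Vec d) (X : Ω → Vec d) (μ : Vec d) (MZ lam : ℝ)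
    (hY : Measurable Y) (hZ : Measurable Z)
    (hYpm : ∀ ω, Y ω = 1 ∨ Y ω = -1)
    (hY1 : P {ω | Y ω = 1} = 1 / 2)
    (hindep : IndepFun Y Z P)
    (hZsg : ∀ u : Vec d, ‖u‖ = 1 → Integrable (fun ω => |⟪u, Z ω⟫| ^ (4:ℝ)) P)
    (hZcov : ∀ u v : Vec d, (∫ ω, ⟪u, Z ω⟫ * ⟪v, Z ω⟫ ∂P) = ⟪u, v⟫)
    (hZsym : ∀ O : Vec d ≃ₗᵢ[ℝ] Vec d,
      Measure.map (fun ω => O (Z ω)) P = Measure.map Z P)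
    (hMZ : ∀ u : Vec d, ‖u‖ = 1 → (∫ ω, ⟪u, Z ω⟫ ^ 4 ∂P) = MZ)
    (hX : ∀ ω, X ω = Y ω • μ + Z ω) : popLoss P X hq lam = polyL μ MZ lam := by
  funext γ
  obtain ⟨a, β⟩ := γ
  simp only [popLoss, polyL, WithLp.equiv_apply]
  set m := ⟪β, μ⟫ with hm
  have i1 := memLp_W P Z hZ hZsg β 1 (by norm_num)
  have i2 := memLp_W P Z hZ hZsg β 2 (by norm_num)
  have i3 := memLp_W P Z hZ hZsg β 3 (by norm_num)
  have i4 := memLp_W P Z hZ hZsg β 4 (by norm_num)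
  have e1 := odd_W P Z hZ hZsym β 1 (by decide)
  have e3 := odd_W P Z hZ hZsym β 3 (by decide)
  have e4 := four_W P Z MZ hMZ β
  have e2 : ∫ ω, ⟪β, Z ω⟫ ^ 2 ∂P = ⟪β, β⟫ := by
    rw [← hZcov β β]; simp only [pow_two]
  set A : ℝ → ℝ := fun w => (a^4+6*a^2*m^2+m^4 -2*(a^2+m^2)+1) + (4*(a^3+3*a*m^2) - 4*a) * w^1
    + (6*(a^2+m^2) -2) * w^2 + (4*a) * w^3 + w^4 with hA
  set B : ℝ → ℝ := fun w => (4*a^3*m+4*a*m^3 -4*a*m) + (4*(3*a^2*m+m^3) -4*m) * w^1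
    + (12*a*m) * w^2 + (4*m) * w^3 with hB
  have hpt : ∀ ω, hq (a + ⟪β, X ω⟫) = (A ⟪β, Z ω⟫ + Y ω * B ⟪β, Z ω⟫) / 4 := by
    intro ω
    rw [hX, inner_add_right, inner_smul_right, ← hm]
    generalize ⟪β, Z ω⟫ = w
    simp only [hq, hA, hB]
    rcases hYpm ω with h | h <;> rw [h] <;> ring
  have hBm : Measurable B := by simp only [hB]; fun_prop
  have iA : Integrable (fun ω => A ⟪β, Z ω⟫) P :=
    ((((integrable_const _).add (i1.const_mul _)).add (i2.const_mul _)).add (i3.const_mul _)).add i4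
  have iB : Integrable (fun ω => B ⟪β, Z ω⟫) P :=
    (((integrable_const _).add (i1.const_mul _)).add (i2.const_mul _)).add (i3.const_mul _)
  have iY : Integrable Y P := by
    refine (integrable_const (1:ℝ)).mono' hY.aestronglyMeasurable
      (Filter.Eventually.of_forall fun ω => ?_)
    rcases hYpm ω with h | h <;> simp [h]
  have hind : IndepFun Y (fun ω => B ⟪β, Z ω⟫) P := by
    have hφ : Measurable (fun z : Vec d => B ⟪β, z⟫) := hBm.comp (by fun_prop)
    exact hindep.comp measurable_id hφ
  have iYB : Integrable (fun ω => Y ω * B ⟪β, Z ω⟫) P := hind.integrable_mul iY iB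
  have eYB : ∫ ω, Y ω * B ⟪β, Z ω⟫ ∂P = 0 := by
    have := hind.integral_fun_mul_eq_mul_integral iY.aestronglyMeasurable iB.aestronglyMeasurable
    rw [this, mean_Y P Y hY hYpm hY1, zero_mul]
  have eA : ∫ ω, A ⟪β, Z ω⟫ ∂P = (a^4+6*a^2*m^2+m^4 -2*(a^2+m^2)+1)
      + (6*(a^2+m^2) -2) * ⟪β, β⟫ + MZ * ⟪β, β⟫ ^ 2 := by
    simp only [hA]
    have j1 : ∀ c0 c1 : ℝ, Integrable (fun ω => c0 + c1 * ⟪β, Z ω⟫ ^ 1) P :=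
      fun c0 c1 => (integrable_const _).add (i1.const_mul _)
    have j2 : ∀ c0 c1 c2 : ℝ, Integrable (fun ω => c0 + c1 * ⟪β, Z ω⟫ ^ 1
        + c2 * ⟪β, Z ω⟫ ^ 2) P :=
      fun c0 c1 c2 => (j1 c0 c1).add (i2.const_mul _)
    have j3 : ∀ c0 c1 c2 c3 : ℝ, Integrable (fun ω => c0 + c1 * ⟪β, Z ω⟫ ^ 1
        + c2 * ⟪β, Z ω⟫ ^ 2 + c3 * ⟪β, Z ω⟫ ^ 3) P :=
      fun c0 c1 c2 c3 => (j2 c0 c1 c2).add (i3.const_mul _)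
    rw [integral_add (j3 _ _ _ _) i4, integral_add (j2 _ _ _) (i3.const_mul _),
      integral_add (j1 _ _) (i2.const_mul _),
      integral_add (integrable_const _) (i1.const_mul _),
      integral_const_mul, integral_const_mul, integral_const_mul, e1, e2, e3, e4,
      real_inner_self_eq_norm_sq]
    simp
  simp only [hpt]
  rw [integral_div, integral_add iA iYB, eYB, eA]
  change _ = (a ^ 4 + 6 * a ^ 2 * m ^ 2 + m ^ 4
    + 6 * (a ^ 2 + m ^ 2) * ⟪β, β⟫ + MZ * ⟪β, β⟫ ^ 2
    - 2 * a ^ 2 - 2 * m ^ 2 - 2 * ⟪β, β⟫ + 1) / 4 + lam / 2 * a ^ 2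
  ring

theorem grad_polyL {d : ℕ} (μ : Vec d) (MZ lam : ℝ) (γ : Pr d) :
    HasGradientAt (polyL μ MZ lam)
      (mkp (γ.fst * (γ.fst ^ 2 + 3 * ⟪γ.snd, μ⟫ ^ 2 + 3 * ⟪γ.snd, γ.snd⟫ + (lam - 1)))
        ((3 * γ.fst ^ 2 * ⟪γ.snd, μ⟫ + ⟪γ.snd, μ⟫ ^ 3 + 3 * ⟪γ.snd, μ⟫ * ⟪γ.snd, γ.snd⟫
          - ⟪γ.snd, μ⟫) • μ
          + (3 * γ.fst ^ 2 + 3 * ⟪γ.snd, μ⟫ ^ 2 + MZ * ⟪γ.snd, γ.snd⟫ - 1) • γ.snd)) γ := by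
  rw [hasGradientAt_iff_hasFDerivAt]
  have h1 : HasFDerivAt (fun γ : Pr d => γ.fst) (WithLp.fstL 2 ℝ ℝ (Vec d)) γ :=
    (WithLp.fstL 2 ℝ ℝ (Vec d)).hasFDerivAt
  have h2 : HasFDerivAt (fun γ : Pr d => γ.snd) (WithLp.sndL 2 ℝ ℝ (Vec d)) γ :=
    (WithLp.sndL 2 ℝ ℝ (Vec d)).hasFDerivAt
  have hm := h2.inner ℝ (hasFDerivAt_const μ γ)
  have hb := h2.inner ℝ h2
  have := (((((((((h1.pow 4).add (((h1.pow 2).const_mul 6).mul (hm.pow 2))).add (hm.pow 4)).add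
    ((((h1.pow 2).add (hm.pow 2)).const_mul 6).mul hb)).add ((hb.pow 2).const_mul MZ)).sub
    ((h1.pow 2).const_mul 2)).sub ((hm.pow 2).const_mul 2)).sub (hb.const_mul 2)).add_const
    1).mul_const (1/4) |>.add ((h1.pow 2).const_mul (lam / 2))
  refine (this.congr_fderiv ?_).congr_of_eventuallyEq (Filter.Eventually.of_forall fun x => ?_)
  · ext v
    simp [mkp, WithLp.prod_inner_apply, inner_add_left, inner_smul_left, real_inner_comm]
    ring
  · simp [polyL]; ring

theorem scalar_min (a x b s M lam : ℝ) (hM : 3 < M) (hlam : 1 ≤ lam) (hs : 0 < s) (hb : 0 ≤ b)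
    (hx : 0 ≤ x) (hxb : x ≤ s * b) :
    (1 - (s + 1) ^ 2 / (s ^ 2 + 6 * s + M)) / 4 ≤
    (a ^ 4 + 6 * a ^ 2 * x + x ^ 2 + 6 * (a ^ 2 + x) * b + M * b ^ 2 - 2 * a ^ 2 - 2 * x - 2 * b + 1)
      / 4 + lam / 2 * a ^ 2 := by
  have hK : 0 < s ^ 2 + 6 * s + M := by positivity
  set K := s ^ 2 + 6 * s + M with hKd
  have h1 : (x + b) ^ 2 * K ≤ (x ^ 2 + 6 * x * b + M * b ^ 2) * (s + 1) ^ 2 := by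
    have : 0 ≤ (s * b - x) * (((M - 1) * s + (2 * M - 6)) * b + (4 * s + M - 1) * x) := by
      have := sub_nonneg.2 hxb
      have h2 : 0 ≤ (M - 1) * s + (2 * M - 6) := by nlinarith
      have h3 : 0 ≤ 4 * s + M - 1 := by linarith
      positivity
    rw [hKd]; nlinarith
  have h2 : -((s + 1) ^ 2 / K) ≤ x ^ 2 + 6 * x * b + M * b ^ 2 - 2 * (x + b) := by
    have h3 : (x + b) ^ 2 * K / (s + 1) ^ 2 ≤ x ^ 2 + 6 * x * b + M * b ^ 2 := by
      rw [div_le_iff₀ (by positivity)]; exact h1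
    have h4 : 0 ≤ (x + b) ^ 2 * K / (s + 1) ^ 2 - 2 * (x + b) + (s + 1) ^ 2 / K := by
      have : (x + b) ^ 2 * K / (s + 1) ^ 2 - 2 * (x + b) + (s + 1) ^ 2 / K
          = ((x + b) * K - (s + 1) ^ 2) ^ 2 / (K * (s + 1) ^ 2) := by
        field_simp; ring
      rw [this]; positivity
    linarith
  have h5 : 0 ≤ a ^ 4 + 6 * a ^ 2 * x + 6 * a ^ 2 * b := by positivity
  have h6 : 0 ≤ (lam - 1) * a ^ 2 := mul_nonneg (by linarith) (sq_nonneg a)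
  nlinarith

theorem polyL_betah {d : ℕ} (μ : Vec d) (M lam : ℝ) (hμ : μ ≠ 0) (hM : 3 < M) (ε : ℝ)
    (hε : ε ^ 2 = 1) :
    polyL μ M lam (mkp 0 (ε • betah μ M)) =
      (1 - (‖μ‖ ^ 2 + 1) ^ 2 / ((‖μ‖ ^ 2) ^ 2 + 6 * ‖μ‖ ^ 2 + M)) / 4 := by
  have hn : 0 < ‖μ‖ := norm_pos_iff.2 hμ
  have hc : (Real.sqrt ((1 + 1 / ‖μ‖ ^ 2) / (‖μ‖ ^ 4 + 6 * ‖μ‖ ^ 2 + M))) ^ 2 =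
    (1 + 1 / ‖μ‖ ^ 2) / (‖μ‖ ^ 4 + 6 * ‖μ‖ ^ 2 + M) := Real.sq_sqrt (by positivity)
  simp only [polyL, mkp, betah, WithLp.equiv_symm_apply]
  set c := Real.sqrt ((1 + 1 / ‖μ‖ ^ 2) / (‖μ‖ ^ 4 + 6 * ‖μ‖ ^ 2 + M)) with hcd
  simp only [WithLp.toLp_fst, WithLp.toLp_snd, inner_smul_left, inner_smul_right,
    real_inner_self_eq_norm_sq, conj_trivial]
  have hK : 0 < ‖μ‖ ^ 4 + 6 * ‖μ‖ ^ 2 + M := by positivity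
  have e4 : ε ^ 4 = 1 := by rw [show ε ^ 4 = (ε ^ 2) ^ 2 by ring, hε]; norm_num
  have c4 : c ^ 4 = (c ^ 2) ^ 2 := by ring
  have : c ^ 2 * (‖μ‖ ^ 4 + 6 * ‖μ‖ ^ 2 + M) * ‖μ‖ ^ 2 = ‖μ‖ ^ 2 + 1 := by
    rw [hc]; field_simp
  have hcc : c ^ 2 * ‖μ‖ ^ 2 = (‖μ‖ ^ 2 + 1) / (‖μ‖ ^ 4 + 6 * ‖μ‖ ^ 2 + M) := by
    rw [eq_div_iff hK.ne']; linarith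
  calc _ = (ε ^ 4 * (c ^ 2 * ‖μ‖ ^ 2) ^ 2 * (‖μ‖ ^ 4 + 6 * ‖μ‖ ^ 2 + M)
      - 2 * ε ^ 2 * (c ^ 2 * ‖μ‖ ^ 2) * (‖μ‖ ^ 2 + 1) + 1) / 4 := by ring
    _ = _ := by
      rw [e4, hε, hcc, show (‖μ‖ ^ 2) ^ 2 = ‖μ‖ ^ 4 by ring]
      field_simp
      ring

theorem polyL_min {d : ℕ} (μ : Vec d) (M lam : ℝ) (hμ : μ ≠ 0) (hM : 3 < M) (hlam : 1 ≤ lam)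
    (γ : Pr d) :
    (1 - (‖μ‖ ^ 2 + 1) ^ 2 / ((‖μ‖ ^ 2) ^ 2 + 6 * ‖μ‖ ^ 2 + M)) / 4 ≤ polyL μ M lam γ := by
  have hn : 0 < ‖μ‖ := norm_pos_iff.2 hμ
  have h := scalar_min γ.fst (⟪γ.snd, μ⟫ ^ 2) ⟪γ.snd, γ.snd⟫ (‖μ‖ ^ 2) M lam hM hlam (by positivity)
    real_inner_self_nonneg (sq_nonneg _) (by
      have := real_inner_mul_inner_self_le γ.snd μ
      rw [real_inner_self_eq_norm_sq μ] at this
      nlinarith)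
  rw [polyL]
  convert h using 3
  ring

theorem stat_iff {d : ℕ} (μ : Vec d) (M lam a : ℝ) (β : Vec d) (hμ : μ ≠ 0) (hM : 3 < M)
    (hlam : 1 ≤ lam) :
    (a * (a ^ 2 + 3 * ⟪β, μ⟫ ^ 2 + 3 * ⟪β, β⟫ + (lam - 1)) = 0 ∧
      (3 * a ^ 2 * ⟪β, μ⟫ + ⟪β, μ⟫ ^ 3 + 3 * ⟪β, μ⟫ * ⟪β, β⟫ - ⟪β, μ⟫) • μ
          + (3 * a ^ 2 + 3 * ⟪β, μ⟫ ^ 2 + M * ⟪β, β⟫ - 1) • β = 0) ↔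
    (a = 0 ∧ ((β = betah μ M ∨ β = -betah μ M) ∨ ((⟪μ, β⟫ = 0 ∧ ‖β‖ ^ 2 = 1 / M) ∨ β = 0))) := by
  have hn : 0 < ‖μ‖ := norm_pos_iff.2 hμ
  have hK : 0 < ‖μ‖ ^ 4 + 6 * ‖μ‖ ^ 2 + M := by positivity
  have hc : (Real.sqrt ((1 + 1 / ‖μ‖ ^ 2) / (‖μ‖ ^ 4 + 6 * ‖μ‖ ^ 2 + M))) ^ 2 =
    (1 + 1 / ‖μ‖ ^ 2) / (‖μ‖ ^ 4 + 6 * ‖μ‖ ^ 2 + M) := Real.sq_sqrt (by positivity)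
  simp only [betah]
  set c := Real.sqrt ((1 + 1 / ‖μ‖ ^ 2) / (‖μ‖ ^ 4 + 6 * ‖μ‖ ^ 2 + M)) with hcd
  have hc' : c ^ 2 * (‖μ‖ ^ 4 + 6 * ‖μ‖ ^ 2 + M) * ‖μ‖ ^ 2 = ‖μ‖ ^ 2 + 1 := by
    rw [hc]; field_simp
  constructor
  · rintro ⟨h1, h2⟩
    have hb : 0 ≤ ⟪β, β⟫ := real_inner_self_nonneg
    have ha : a = 0 := by
      rcases mul_eq_zero.1 h1 with h | h
      · exact h
      · have := sq_nonneg ⟪β, μ⟫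
        have : a ^ 2 = 0 := by
          have := sq_nonneg a
          linarith
        exact pow_eq_zero_iff (two_ne_zero) |>.1 this
    refine ⟨ha, ?_⟩
    subst ha
    by_cases hm : ⟪β, μ⟫ = 0
    · right
      by_cases hβ : β = 0
      · exact Or.inr hβ
      · left
        refine ⟨by rw [real_inner_comm]; exact hm, ?_⟩
        rw [hm] at h2
        have : M * ⟪β, β⟫ - 1 = 0 := by simpa [hβ] using h2
        rw [real_inner_self_eq_norm_sq] at this
        field_simp
        linarith
    · left
      by_cases hq0 : 3 * ⟪β, μ⟫ ^ 2 + M * ⟪β, β⟫ - 1 = 0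
      · exfalso
        have h3 : (⟪β, μ⟫ * (⟪β, μ⟫ ^ 2 + 3 * ⟪β, β⟫ - 1)) • μ = 0 := by
          have e : (3 * (0:ℝ) ^ 2 + 3 * ⟪β, μ⟫ ^ 2 + M * ⟪β, β⟫ - 1) = 0 := by linarith
          rw [e, zero_smul, add_zero] at h2
          rw [← h2]; congr 1; ring
        have h4 : ⟪β, μ⟫ ^ 2 + 3 * ⟪β, β⟫ - 1 = 0 := by
          simpa [hm, hμ] using h3
        have hm2 : 0 < ⟪β, μ⟫ ^ 2 := by positivity
        nlinarith
      · obtain ⟨t, ht⟩ : ∃ t : ℝ, β = t • μ := by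
          refine ⟨-((3 * ⟪β, μ⟫ ^ 2 + M * ⟪β, β⟫ - 1)⁻¹ *
            (⟪β, μ⟫ ^ 3 + 3 * ⟪β, μ⟫ * ⟪β, β⟫ - ⟪β, μ⟫)), ?_⟩
          have h3 := congrArg (fun v => (3 * ⟪β, μ⟫ ^ 2 + M * ⟪β, β⟫ - 1)⁻¹ • v) h2
          simp only [smul_add, smul_smul, smul_zero] at h3
          have e : (3 * ⟪β, μ⟫ ^ 2 + M * ⟪β, β⟫ - 1)⁻¹ *
            (3 * (0:ℝ) ^ 2 + 3 * ⟪β, μ⟫ ^ 2 + M * ⟪β, β⟫ - 1) = 1 := by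
            refine Eq.trans ?_ (inv_mul_cancel₀ hq0)
            congr 1; ring
          rw [e, one_smul] at h3
          refine (eq_neg_of_add_eq_zero_right h3).trans ?_
          rw [← neg_smul]
          congr 1
          ring
        have ht0 : t ≠ 0 := by
          rintro rfl
          apply hm; rw [ht]; simp
        have e1 : ⟪β, μ⟫ = t * ‖μ‖ ^ 2 := by
          rw [ht, inner_smul_left, real_inner_self_eq_norm_sq]; simp
        have e2 : ⟪β, β⟫ = t ^ 2 * ‖μ‖ ^ 2 := by
          rw [ht, inner_smul_left, inner_smul_right, real_inner_self_eq_norm_sq]; simp; ring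
        rw [e1, e2] at h2
        rw [ht, smul_smul, ← add_smul] at h2
        have h3 := (smul_eq_zero.1 h2).resolve_right hμ
        have h4 : t * (t ^ 2 * (‖μ‖ ^ 4 + 6 * ‖μ‖ ^ 2 + M) * ‖μ‖ ^ 2 - (‖μ‖ ^ 2 + 1)) = 0 := by
          rw [← h3]; ring
        have h5 := (mul_eq_zero.1 h4).resolve_left ht0
        have h6 : t ^ 2 = c ^ 2 := by
          have : (t ^ 2 - c ^ 2) * ((‖μ‖ ^ 4 + 6 * ‖μ‖ ^ 2 + M) * ‖μ‖ ^ 2) = 0 := by linarith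
          rcases mul_eq_zero.1 this with h | h
          · linarith
          · exact absurd h (by positivity)
        rcases sq_eq_sq_iff_eq_or_eq_neg.1 h6 with h | h
        · left; rw [ht, h]
        · right; rw [ht, h, neg_smul]
  · rintro ⟨rfl, h⟩
    refine ⟨by ring, ?_⟩
    have key : ∀ t : ℝ, t ^ 2 = c ^ 2 → β = t • μ →
      (3 * (0:ℝ) ^ 2 * ⟪β, μ⟫ + ⟪β, μ⟫ ^ 3 + 3 * ⟪β, μ⟫ * ⟪β, β⟫ - ⟪β, μ⟫) • μ
          + (3 * (0:ℝ) ^ 2 + 3 * ⟪β, μ⟫ ^ 2 + M * ⟪β, β⟫ - 1) • β = 0 := by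
      intro t h6 ht
      have e1 : ⟪β, μ⟫ = t * ‖μ‖ ^ 2 := by
        rw [ht, inner_smul_left, real_inner_self_eq_norm_sq]; simp
      have e2 : ⟪β, β⟫ = t ^ 2 * ‖μ‖ ^ 2 := by
        rw [ht, inner_smul_left, inner_smul_right, real_inner_self_eq_norm_sq]; simp; ring
      rw [e1, e2, ht, smul_smul, ← add_smul]
      rw [← h6] at hc'
      have h4 : t * (t ^ 2 * (‖μ‖ ^ 4 + 6 * ‖μ‖ ^ 2 + M) * ‖μ‖ ^ 2 - (‖μ‖ ^ 2 + 1)) = 0 := by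
        rw [hc']; ring
      convert zero_smul ℝ μ using 2
      refine Eq.trans ?_ h4
      ring
    rcases h with (h | h) | (⟨h, h'⟩ | h)
    · exact key c rfl h
    · exact key (-c) (by ring) (by rw [h, neg_smul])
    · rw [real_inner_comm] at h
      rw [h, real_inner_self_eq_norm_sq, h', mul_one_div_cancel (by positivity)]
      simp
    · subst h; simp

/-- under the centered model with `M_Z > 3` and `λ ≥ 1`, the stationary points
of the quartic population loss `L^h_λ` are exactly `S₁ ∪ S₂`, with
`S₁ = {(0, β^h), (0, −β^h)}` and `S₂ = {(0, β) : μ⊤β = 0, ‖β‖² = 1/M_Z} ∪ {(0,0)}`;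
moreover both points of `S₁` are global minimizers. -/
theorem quartic_population_loss_stationary_points
    {d : ℕ} {Ω : Type*} [MeasurableSpace Ω] (P : Measure Ω) [IsProbabilityMeasure P]
    (Y : Ω → ℝ) (Z : Ω → Vec d) (X : Ω → Vec d) (μ : Vec d) (M MZ lam : ℝ)
    (hμ : μ ≠ 0) (hlam : 0 ≤ lam)
    (hY : Measurable Y) (hZ : Measurable Z)
    (hYpm : ∀ ω, Y ω = 1 ∨ Y ω = -1)
    (hY1 : P {ω | Y ω = 1} = 1 / 2) (hY2 : P {ω | Y ω = -1} = 1 / 2)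
    (hindep : IndepFun Y Z P)
    (hZsg : ∀ u : Vec d, ‖u‖ = 1 → ∀ p : ℝ, 1 ≤ p →
      Integrable (fun ω => |⟪u, Z ω⟫| ^ p) P ∧
        (∫ ω, |⟪u, Z ω⟫| ^ p ∂P) ^ (1 / p) ≤ Real.sqrt p * M)
    (hZmean : (∫ ω, Z ω ∂P) = 0)
    (hZcov : ∀ u v : Vec d, (∫ ω, ⟪u, Z ω⟫ * ⟪v, Z ω⟫ ∂P) = ⟪u, v⟫)
    (hZsym : ∀ O : Vec d ≃ₗᵢ[ℝ] Vec d,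
      Measure.map (fun ω => O (Z ω)) P = Measure.map Z P)
    (hMZ : ∀ u : Vec d, ‖u‖ = 1 → (∫ ω, ⟪u, Z ω⟫ ^ 4 ∂P) = MZ)
    (hX : ∀ ω, X ω = Y ω • μ + Z ω)
    (hMZ3 : 3 < MZ) (hlam1 : 1 ≤ lam) :
    ({γ : Pr d | gradient (popLoss P X hq lam) γ = 0} =
      ({mkp 0 (betah μ MZ), mkp 0 (-(betah μ MZ))} ∪
        ({γ : Pr d | ∃ β : Vec d, γ = mkp 0 β ∧ ⟪μ, β⟫ = 0 ∧ ‖β‖ ^ 2 = 1 / MZ}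
          ∪ {mkp 0 0}))) ∧
    (∀ γ : Pr d, popLoss P X hq lam (mkp 0 (betah μ MZ)) ≤ popLoss P X hq lam γ) ∧
    (∀ γ : Pr d, popLoss P X hq lam (mkp 0 (-(betah μ MZ))) ≤ popLoss P X hq lam γ) := by
  have hL : popLoss P X hq lam = polyL μ MZ lam :=
    popLoss_eq P Y Z X μ MZ lam hY hZ hYpm hY1 hindep
      (fun u hu => (hZsg u hu 4 (by norm_num)).1) hZcov hZsym hMZ hX
  rw [hL]
  refine ⟨?_, fun γ => ?_, fun γ => ?_⟩
  · ext γ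
    obtain ⟨a, β⟩ := γ
    have hinj : ∀ (x x' : ℝ) (y y' : Vec d), mkp x y = mkp x' y' ↔ x = x' ∧ y = y' := by
      intro x x' y y'
      simp [mkp]
    have hz : (0 : Pr d) = mkp 0 0 := rfl
    have hγ : (WithLp.toLp 2 (a, β) : Pr d) = mkp a β := rfl
    have hs := stat_iff μ MZ lam a β hμ hMZ3 hlam1
    simp only [Set.mem_ofPred_eq, (grad_polyL μ MZ lam _).gradient, hz, hinj]
    refine hs.trans ?_
    simp only [hγ, Set.mem_union, Set.mem_insert_iff, Set.mem_singleton_iff, Set.mem_ofPred_eq, hinj]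
    constructor
    · rintro ⟨h, (h' | h') | (h' | h')⟩
      · exact Or.inl (Or.inl ⟨h, h'⟩)
      · exact Or.inl (Or.inr ⟨h, h'⟩)
      · exact Or.inr (Or.inl ⟨β, ⟨h, rfl⟩, h'⟩)
      · exact Or.inr (Or.inr ⟨h, h'⟩)
    · rintro ((⟨h, h'⟩ | ⟨h, h'⟩) | (⟨b, ⟨h, rfl⟩, h'⟩ | ⟨h, h'⟩))
      · exact ⟨h, Or.inl (Or.inl h')⟩
      · exact ⟨h, Or.inl (Or.inr h')⟩
      · exact ⟨h, Or.inr (Or.inl h')⟩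
      · exact ⟨h, Or.inr (Or.inr h')⟩
  · have := polyL_betah μ MZ lam hμ hMZ3 1 (by norm_num)
    rw [one_smul] at this
    rw [this]
    exact polyL_min μ MZ lam hμ hMZ3 hlam1 γ
  · have := polyL_betah μ MZ lam hμ hMZ3 (-1) (by norm_num)
    rw [neg_one_smul] at this
    rw [this]
    exact polyL_min μ MZ lam hμ hMZ3 hlam1 γ
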